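/- Let A be a rational map of the Riemann sphere of degree m ≥ 2 and let O be an orbifold on ℂP¹ having exactly two singular points, both with ν equal to some n ≥ 2 (i.e. signature {n, n}), such that A : O → O is a minimal holomorphic map between orbifolds. Then m ≥ n, unless A is conjugate to z ↦ z^m or to z ↦ z^{−m}. -/

import Mathlib

open Polynomial OnePoint
open scoped Classical

noncomputable section

namespace GenLattes

/-- Composition of rational functions: `rcomp f g = f ∘ g`. -/
def rcomp (f g : RatFunc ℂ) : RatFunc ℂ :=
  Polynomial.aeval g f.num / Polynomial.aeval g f.denom

/-- The degree of a rational function: the maximum of the degrees of its numerator and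
denominator in lowest terms. -/
def rdeg (f : RatFunc ℂ) : ℕ := max f.num.natDegree f.denom.natDegree

/-- Evaluation of a rational function at a finite point, with value in the Riemann
sphere `ℂP¹ = OnePoint ℂ`. -/
def evalF (f : RatFunc ℂ) (z : ℂ) : OnePoint ℂ :=
  if f.denom.eval z = 0 then ∞ else ((f.num.eval z / f.denom.eval z : ℂ) : OnePoint ℂ)

/-- The local degree (local multiplicity) of a rational function at a finite point. -/
def locDegF (f : RatFunc ℂ) (z : ℂ) : ℕ :=
  if f.denom.eval z = 0 then rootMultiplicity z f.denom
  else rootMultiplicity z (f.num - Polynomial.C (f.num.eval z / f.denom.eval z) * f.denom)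

/-- The rational function `f(1/X)`. -/
def flip (f : RatFunc ℂ) : RatFunc ℂ := rcomp f (RatFunc.X)⁻¹

/-- The self-map of the Riemann sphere `ℂP¹ = OnePoint ℂ` induced by a rational function. -/
def evalOP (f : RatFunc ℂ) (x : OnePoint ℂ) : OnePoint ℂ :=
  OnePoint.rec (evalF (flip f) 0) (fun z => evalF f z) x

/-- The local degree `deg_x f` of a rational function at a point of the Riemann sphere. -/
def locDeg (f : RatFunc ℂ) (x : OnePoint ℂ) : ℕ :=
  OnePoint.rec (locDegF (flip f) 0) (fun z => locDegF f z) x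

/-- The iterate `f^{∘l}` of a rational function (with `riter f 0 = X = id`). -/
def riter (f : RatFunc ℂ) : ℕ → RatFunc ℂ
  | 0 => RatFunc.X
  | l + 1 => rcomp f (riter f l)

/-- An orbifold on the Riemann sphere: a ramification function `ν : ℂP¹ → ℕ` with
`ν(z) ≥ 1` everywhere and `ν(z) = 1` outside a finite set. -/
structure Orbifold where
  nu : OnePoint ℂ → ℕ
  one_le : ∀ z, 1 ≤ nu z
  finite : {z : OnePoint ℂ | nu z ≠ 1}.Finite

/-- A good orbifold: it is forbidden to have exactly one point with `ν > 1`, or exactly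
two such points with different values of `ν`. -/
def Orbifold.Good (O : Orbifold) : Prop :=
  (¬ ∃ z, {w : OnePoint ℂ | O.nu w ≠ 1} = {z}) ∧
  (¬ ∃ z₁ z₂, z₁ ≠ z₂ ∧ {w : OnePoint ℂ | O.nu w ≠ 1} = {z₁, z₂} ∧ O.nu z₁ ≠ O.nu z₂)

/-- A nontrivial orbifold (distinct from the non-ramified sphere). -/
def Orbifold.IsNontrivial (O : Orbifold) : Prop := ∃ z, 1 < O.nu z

/-- The relation `O₁ ⪯ O₂`: pointwise divisibility of ramification functions. -/
def Orbifold.Prec (O₁ O₂ : Orbifold) : Prop := ∀ z, O₁.nu z ∣ O₂.nu z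

/-- The signature of an orbifold: the multiset of values of `ν` on `c(O) = {ν > 1}`. -/
def Orbifold.signature (O : Orbifold) : Multiset ℕ := O.finite.toFinset.val.map O.nu

/-- The Euler characteristic `χ(O) = 2 + Σ (1/ν(z) - 1)`. -/
def Orbifold.eulerChar (O : Orbifold) : ℚ :=
  2 + ∑ z ∈ O.finite.toFinset, ((O.nu z : ℚ)⁻¹ - 1)

/-- `A : O₁ → O₂` is a holomorphic map between orbifolds:
`ν₂(A(z)) ∣ ν₁(z)·deg_z A` for all `z`. -/
def IsHolo (A : RatFunc ℂ) (O₁ O₂ : Orbifold) : Prop :=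
  ∀ z, O₂.nu (evalOP A z) ∣ O₁.nu z * locDeg A z

/-- `A : O₁ → O₂` is a minimal holomorphic map between orbifolds:
`ν₂(A(z)) = ν₁(z)·gcd(deg_z A, ν₂(A(z)))` for all `z`. -/
def IsMinHolo (A : RatFunc ℂ) (O₁ O₂ : Orbifold) : Prop :=
  ∀ z, O₂.nu (evalOP A z) = O₁.nu z * Nat.gcd (locDeg A z) (O₂.nu (evalOP A z))

/-- `A : O₁ → O₂` is a covering map between orbifolds:
`ν₂(A(z)) = ν₁(z)·deg_z A` for all `z`. -/
def IsCovering (A : RatFunc ℂ) (O₁ O₂ : Orbifold) : Prop :=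
  ∀ z, O₂.nu (evalOP A z) = O₁.nu z * locDeg A z

/-- `A` and `B` are conjugate by a Möbius transformation: `A = μ ∘ B ∘ μ⁻¹`. -/
def Conjugate (A B : RatFunc ℂ) : Prop :=
  ∃ μ ν : RatFunc ℂ, rcomp μ ν = RatFunc.X ∧ rcomp ν μ = RatFunc.X ∧
    A = rcomp (rcomp μ B) ν

/-- The Chebyshev polynomial `T_d` viewed as a rational function. -/
def chebyRF (d : ℕ) : RatFunc ℂ :=
  algebraMap (Polynomial ℂ) (RatFunc ℂ) (Polynomial.Chebyshev.T ℂ d)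

end GenLattes

namespace GenLattes

/-- Precomposition with a nonconstant rational function, as a homomorphism of fields. -/
def compHom {g : RatFunc ℂ} (hg : Transcendental ℂ g) : RatFunc ℂ →ₐ[ℂ] RatFunc ℂ :=
  RatFunc.liftAlgHom (Polynomial.aeval g)
    (nonZeroDivisors_le_comap_nonZeroDivisors_of_injective _
      (transcendental_iff_injective.mp hg))

theorem compHom_apply {g : RatFunc ℂ} (hg : Transcendental ℂ g) (f : RatFunc ℂ) :
    compHom hg f = rcomp f g :=
  RatFunc.liftAlgHom_apply _ _ _

theorem compHom_X {g : RatFunc ℂ} (hg : Transcendental ℂ g) : compHom hg RatFunc.X = g := by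
  simp [compHom_apply, rcomp]

theorem compHom_C {g : RatFunc ℂ} (hg : Transcendental ℂ g) (c : ℂ) :
    compHom hg (RatFunc.C c) = RatFunc.C c := by
  rw [← RatFunc.algebraMap_eq_C]
  exact (compHom hg).commutes c

theorem rcomp_rcomp {g h : RatFunc ℂ} (f : RatFunc ℂ) (hg : Transcendental ℂ g) :
    rcomp (rcomp f h) g = rcomp f (rcomp h g) := by
  rw [← compHom_apply hg, rcomp, map_div₀, ← Polynomial.aeval_algHom_apply,
    ← Polynomial.aeval_algHom_apply, compHom_apply]
  rfl

theorem isAlgebraic_C (c : ℂ) : IsAlgebraic ℂ (RatFunc.C c) := by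
  rw [← RatFunc.algebraMap_eq_C]
  exact isAlgebraic_algebraMap c

theorem transcendental_zpow {g : RatFunc ℂ} (hg : Transcendental ℂ g) {e : ℤ} (he : e ≠ 0) :
    Transcendental ℂ (g ^ e) := by
  obtain ⟨k, rfl | rfl⟩ := e.eq_nat_or_neg
  · rw [zpow_natCast]
    exact hg.pow (by lia)
  · rw [zpow_neg, zpow_natCast]
    exact fun h ↦ hg.pow (n := k) (by lia) (by simpa using h.inv)

theorem conjugate_zpow {A μ ν : RatFunc ℂ} {e : ℤ} (hν : Transcendental ℂ ν)
    (h₁ : rcomp μ ν = RatFunc.X) (h₂ : rcomp ν μ = RatFunc.X) (hA : A = rcomp μ (ν ^ e)) :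
    Conjugate A (RatFunc.X ^ e) := by
  refine ⟨μ, ν, h₁, h₂, ?_⟩
  rw [rcomp_rcomp _ hν, ← compHom_apply hν (_ ^ e), map_zpow₀, compHom_X, hA]

theorem exists_zpow_eq {c : ℂ} (hc : c ≠ 0) {e : ℤ} (he : e ≠ 0) :
    ∃ l : ℂ, l ≠ 0 ∧ l ^ e = c := by
  obtain ⟨k, rfl | rfl⟩ := e.eq_nat_or_neg
  · obtain ⟨l, hl⟩ := IsAlgClosed.exists_pow_nat_eq c (n := k) (by lia)
    exact ⟨l, by rintro rfl; simp_all [zero_pow], by simpa using hl⟩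
  · obtain ⟨l, hl⟩ := IsAlgClosed.exists_pow_nat_eq c⁻¹ (n := k) (by lia)
    refine ⟨l, ?_, by simp [hl]⟩
    rintro rfl
    rw [zero_pow (by lia)] at hl
    exact inv_ne_zero hc hl.symm

theorem X_ne_C (a : ℂ) : (RatFunc.X : RatFunc ℂ) ≠ RatFunc.C a := fun h ↦
  RatFunc.transcendental_X (K := ℂ) (h ▸ isAlgebraic_C a)

theorem C_ne_zero {a : ℂ} (ha : a ≠ 0) : RatFunc.C a ≠ 0 := by simpa using ha

theorem conjugate_of_affine {A : RatFunc ℂ} {a c : ℂ} (hc : c ≠ 0) {e : ℤ} (h₀ : e ≠ 0)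
    (h₁ : e ≠ 1) (hA : A = RatFunc.C a + RatFunc.C c * (RatFunc.X - RatFunc.C a) ^ e) :
    Conjugate A (RatFunc.X ^ e) := by
  obtain ⟨l, hl, hle⟩ := exists_zpow_eq hc (sub_ne_zero.mpr h₁.symm)
  have hL := C_ne_zero hl
  set L := RatFunc.C l with hLdef
  have hν : Transcendental ℂ ((RatFunc.X - RatFunc.C a) / L) := by
    intro h
    refine RatFunc.transcendental_X (K := ℂ) ?_
    rw [show (RatFunc.X : RatFunc ℂ) = RatFunc.C a + L * ((RatFunc.X - RatFunc.C a) / L) by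
      field_simp; ring]
    exact (isAlgebraic_C a).add ((isAlgebraic_C l).mul h)
  have hμ : Transcendental ℂ (RatFunc.C a + L * RatFunc.X) := by
    intro h
    refine RatFunc.transcendental_X (K := ℂ) ?_
    rw [show (RatFunc.X : RatFunc ℂ) = (RatFunc.C a + L * RatFunc.X - RatFunc.C a) * L⁻¹ by
      field_simp; ring]
    exact (h.sub (isAlgebraic_C a)).mul (isAlgebraic_C l).inv
  refine conjugate_zpow (μ := RatFunc.C a + L * RatFunc.X)
    (ν := (RatFunc.X - RatFunc.C a) / L) hν ?_ ?_ ?_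
  · rw [← compHom_apply hν, map_add, map_mul, compHom_C, compHom_C, compHom_X]
    field_simp; ring
  · rw [← compHom_apply hμ, map_div₀, map_sub, compHom_C, compHom_C, compHom_X, ← hLdef]
    field_simp; ring
  · rw [← compHom_apply (transcendental_zpow hν h₀), map_add, map_mul, compHom_C, compHom_C,
      compHom_X, hA, ← hle, map_zpow₀, ← hLdef, zpow_sub₀ hL, zpow_one, div_zpow]
    field_simp

theorem conjugate_of_crossRatio {A : RatFunc ℂ} {a b c : ℂ} (hab : a ≠ b) (hc : c ≠ 0) {e : ℤ}
    (h₀ : e ≠ 0) (h₁ : e ≠ 1) (hAb : A ≠ RatFunc.C b)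
    (hA : (A - RatFunc.C a) / (A - RatFunc.C b) =
      RatFunc.C c * ((RatFunc.X - RatFunc.C a) / (RatFunc.X - RatFunc.C b)) ^ e) :
    Conjugate A (RatFunc.X ^ e) := by
  obtain ⟨l, hl, hle⟩ := exists_zpow_eq hc (sub_ne_zero.mpr h₁.symm)
  have hL := C_ne_zero hl
  have hX := RatFunc.transcendental_X (K := ℂ)
  set L := RatFunc.C l with hLdef
  have hba : RatFunc.C a - RatFunc.C b ≠ 0 := by
    rw [← map_sub]
    exact C_ne_zero (sub_ne_zero.mpr hab)
  have hXb : (RatFunc.X : RatFunc ℂ) - RatFunc.C b ≠ 0 := sub_ne_zero.mpr (X_ne_C b)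
  set ν : RatFunc ℂ := (RatFunc.X - RatFunc.C a) / (L * (RatFunc.X - RatFunc.C b)) with hνdef
  set μ : RatFunc ℂ := (RatFunc.C a - RatFunc.C b * (L * RatFunc.X)) / (1 - L * RatFunc.X)
    with hμdef
  have hLX : (1 : RatFunc ℂ) - L * RatFunc.X ≠ 0 := by
    intro h
    refine X_ne_C l⁻¹ ?_
    rw [map_inv₀, ← hLdef]
    refine eq_inv_of_mul_eq_one_left ?_
    linear_combination -h
  have hLν : 1 - L * ν = (RatFunc.C a - RatFunc.C b) / (RatFunc.X - RatFunc.C b) := by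
    rw [hνdef]; field_simp; ring
  have hμν : (RatFunc.C a - RatFunc.C b * (L * ν)) / (1 - L * ν) = RatFunc.X := by
    rw [hLν, hνdef]; field_simp; ring
  have hμb : μ - RatFunc.C b = (RatFunc.C a - RatFunc.C b) / (1 - L * RatFunc.X) := by
    rw [hμdef]; field_simp; ring
  have hνμ : (μ - RatFunc.C a) / (L * (μ - RatFunc.C b)) = RatFunc.X := by
    rw [hμb, hμdef]; field_simp; ring
  have h1 : IsAlgebraic ℂ (1 : RatFunc ℂ) := isAlgebraic_one
  have hν : Transcendental ℂ ν := by
    intro h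
    refine hX ?_
    rw [← hμν, div_eq_mul_inv]
    have h2 := (isAlgebraic_C l).mul h
    exact ((isAlgebraic_C a).sub ((isAlgebraic_C b).mul h2)).mul (h1.sub h2).inv
  have hμ : Transcendental ℂ μ := by
    intro h
    refine hX ?_
    rw [← hνμ, div_eq_mul_inv]
    exact (h.sub (isAlgebraic_C a)).mul
      ((isAlgebraic_C l).mul (h.sub (isAlgebraic_C b))).inv
  have hcomp : ∀ {g : RatFunc ℂ} (hg : Transcendental ℂ g),
      rcomp μ g = (RatFunc.C a - RatFunc.C b * (L * g)) / (1 - L * g) := fun hg ↦ by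
    rw [← compHom_apply hg, hμdef]
    simp only [map_div₀, map_sub, map_mul, map_one, compHom_X, compHom_C, hLdef]
  refine conjugate_zpow hν ?_ ?_ ?_ (μ := μ)
  · rw [hcomp hν, hμν]
  · rw [← hνμ, ← compHom_apply hμ, hνdef]
    simp only [map_div₀, map_sub, map_mul, compHom_X, compHom_C, hLdef]
  · have hW : L * ν ^ e = (A - RatFunc.C a) / (A - RatFunc.C b) := by
      rw [hA, ← hle, map_zpow₀, ← hLdef, zpow_sub₀ hL, zpow_one, hνdef,
        mul_comm L (_ - _), ← div_div, div_zpow _ L]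
      field_simp
    have hAb' := sub_ne_zero.mpr hAb
    have hW1 : 1 - (A - RatFunc.C a) / (A - RatFunc.C b) =
        (RatFunc.C a - RatFunc.C b) / (A - RatFunc.C b) := by
      field_simp; ring
    rw [hcomp (transcendental_zpow hν h₀), hW, hW1]
    field_simp; ring

/-- The polynomial whose roots are the finite points of the fibre of `f` over `w`. -/
def fibrePoly (f : RatFunc ℂ) (w : OnePoint ℂ) : ℂ[X] :=
  OnePoint.rec f.denom (fun c ↦ f.num - Polynomial.C c * f.denom) w

theorem fibrePoly_infty (f : RatFunc ℂ) : fibrePoly f ∞ = f.denom := rfl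

theorem fibrePoly_coe (f : RatFunc ℂ) (c : ℂ) :
    fibrePoly f (c : OnePoint ℂ) = f.num - Polynomial.C c * f.denom := rfl

theorem natDegree_fibrePoly_le (f : RatFunc ℂ) (w : OnePoint ℂ) :
    (fibrePoly f w).natDegree ≤ rdeg f := by
  induction w using OnePoint.rec with
  | infty => exact le_max_right _ _
  | coe c =>
    refine (natDegree_sub_le _ _).trans (max_le_max le_rfl ?_)
    exact natDegree_C_mul_le _ _

theorem algebraMap_fibrePoly (f : RatFunc ℂ) (c : ℂ) :
    algebraMap ℂ[X] (RatFunc ℂ) (fibrePoly f (c : OnePoint ℂ)) =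
      (f - RatFunc.C c) * algebraMap ℂ[X] (RatFunc ℂ) f.denom := by
  have h : algebraMap ℂ[X] (RatFunc ℂ) f.denom ≠ 0 := RatFunc.algebraMap_ne_zero f.denom_ne_zero
  have h2 := f.num_div_denom
  rw [div_eq_iff h] at h2
  rw [fibrePoly_coe, map_sub, map_mul, RatFunc.algebraMap_C, h2]
  ring

theorem fibrePoly_ne_zero {f : RatFunc ℂ} (hf : ∀ c, f ≠ RatFunc.C c) (w : OnePoint ℂ) :
    fibrePoly f w ≠ 0 := by
  induction w using OnePoint.rec with
  | infty => exact f.denom_ne_zero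
  | coe c =>
    intro h
    have h2 := algebraMap_fibrePoly f c
    rw [h, map_zero, eq_comm, mul_eq_zero, sub_eq_zero] at h2
    exact h2.elim (hf c) (RatFunc.algebraMap_ne_zero f.denom_ne_zero)

theorem eval_num_ne_zero {f : RatFunc ℂ} {z : ℂ} (h : f.denom.eval z = 0) :
    f.num.eval z ≠ 0 := by
  obtain ⟨a, b, hab⟩ := f.isCoprime_num_denom
  intro h2
  simpa [h, h2] using congrArg (Polynomial.eval z) hab

theorem evalF_eq_iff (f : RatFunc ℂ) (z : ℂ) (w : OnePoint ℂ) :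
    evalF f z = w ↔ (fibrePoly f w).eval z = 0 := by
  rw [evalF]
  induction w using OnePoint.rec with
  | infty => simp [fibrePoly_infty]
  | coe c =>
    rw [fibrePoly_coe]
    split_ifs with h
    · simp [h, eval_num_ne_zero h]
    · rw [OnePoint.coe_eq_coe, div_eq_iff h]
      simp [sub_eq_zero]

theorem locDegF_eq (f : RatFunc ℂ) (z : ℂ) :
    locDegF f z = rootMultiplicity z (fibrePoly f (evalF f z)) := by
  rw [locDegF, evalF]
  split_ifs <;> rfl

theorem locDegF_pos {f : RatFunc ℂ} (hf : ∀ c, f ≠ RatFunc.C c) (z : ℂ) : 0 < locDegF f z := by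
  rw [locDegF_eq, rootMultiplicity_pos (fibrePoly_ne_zero hf _)]
  exact (evalF_eq_iff f z _).mp rfl

theorem locDegF_le (f : RatFunc ℂ) (z : ℂ) : locDegF f z ≤ rdeg f := by
  rw [locDegF_eq, ← count_roots]
  exact ((Multiset.count_le_card _ _).trans (card_roots' _)).trans (natDegree_fibrePoly_le _ _)

theorem transcendental_inv_X : Transcendental ℂ (RatFunc.X : RatFunc ℂ)⁻¹ := by
  simpa using transcendental_zpow (RatFunc.transcendental_X (K := ℂ)) (e := -1) (by decide)

theorem flip_ne_C {f : RatFunc ℂ} (hf : ∀ c, f ≠ RatFunc.C c) (c : ℂ) : flip f ≠ RatFunc.C c := by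
  intro h
  refine hf c ((compHom transcendental_inv_X : RatFunc ℂ →+* RatFunc ℂ).injective ?_)
  rw [RingHom.coe_coe, compHom_apply, compHom_C]
  exact h

theorem aeval_inv_X_mul {p : ℂ[X]} {N : ℕ} (hp : p.natDegree ≤ N) :
    Polynomial.aeval (RatFunc.X : RatFunc ℂ)⁻¹ p * RatFunc.X ^ N =
      algebraMap ℂ[X] (RatFunc ℂ) (reflect N p) := by
  have hX : (RatFunc.X : RatFunc ℂ) ≠ 0 := RatFunc.X_ne_zero
  let := invertibleOfNonzero hX
  have h := eval₂_reflect_mul_pow (algebraMap ℂ (RatFunc ℂ)) RatFunc.X N (reflect N p)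
    (natDegree_reflect_le.trans (max_le le_rfl hp))
  have hr : reflect N (reflect N p) = p := by ext; simp
  rw [hr, invOf_eq_inv] at h
  rw [Polynomial.aeval_def, h, ← Polynomial.aeval_def, ← RatFunc.algebraMap_X,
    Polynomial.aeval_algebraMap_apply]
  simp

theorem flip_eq (f : RatFunc ℂ) :
    flip f = algebraMap ℂ[X] (RatFunc ℂ) (reflect (rdeg f) f.num) /
      algebraMap ℂ[X] (RatFunc ℂ) (reflect (rdeg f) f.denom) := by
  rw [← aeval_inv_X_mul (N := rdeg f) (le_max_left _ _),
    ← aeval_inv_X_mul (N := rdeg f) (le_max_right _ _), mul_div_mul_right _ _ (pow_ne_zero _ RatFunc.X_ne_zero)]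
  rfl

theorem reflect_denom_ne_zero (f : RatFunc ℂ) : reflect (rdeg f) f.denom ≠ 0 := by
  simpa using f.denom_ne_zero

theorem rdeg_flip_le {f : RatFunc ℂ} (hf : ∀ c, f ≠ RatFunc.C c) : rdeg (flip f) ≤ rdeg f := by
  have hd := reflect_denom_ne_zero f
  have hn : reflect (rdeg f) f.num ≠ 0 := by
    rw [Ne, reflect_eq_zero_iff, RatFunc.num_eq_zero_iff]
    simpa using hf 0
  rw [rdeg, flip_eq]
  refine max_le ((natDegree_le_of_dvd (RatFunc.num_div_dvd _ hd) hn).trans ?_)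
    ((natDegree_le_of_dvd (RatFunc.denom_div_dvd _ _) hd).trans ?_)
  · exact natDegree_reflect_le.trans (max_le le_rfl (le_max_left _ _))
  · exact natDegree_reflect_le.trans (max_le le_rfl (le_max_right _ _))

theorem locDeg_pos {f : RatFunc ℂ} (hf : ∀ c, f ≠ RatFunc.C c) (z : OnePoint ℂ) :
    0 < locDeg f z := by
  induction z using OnePoint.rec with
  | infty => exact locDegF_pos (flip_ne_C hf) 0
  | coe c => exact locDegF_pos hf c

theorem locDeg_le {f : RatFunc ℂ} (hf : ∀ c, f ≠ RatFunc.C c) (z : OnePoint ℂ) :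
    locDeg f z ≤ rdeg f := by
  induction z using OnePoint.rec with
  | infty => exact (locDegF_le _ 0).trans (rdeg_flip_le hf)
  | coe c => exact locDegF_le f c

/-- If a fibre polynomial over a finite value has non-maximal degree, then `∞` is in the fibre. -/
theorem evalOP_infty_eq {f : RatFunc ℂ} {a : ℂ}
    (h : (fibrePoly f (a : OnePoint ℂ)).natDegree < rdeg f) : evalOP f ∞ = a := by
  have hc := coeff_eq_zero_of_natDegree_lt h
  rw [fibrePoly_coe, coeff_sub, coeff_C_mul, sub_eq_zero] at hc
  have hcd : f.denom.coeff (rdeg f) ≠ 0 := by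
    intro h0
    rw [h0, mul_zero] at hc
    have hpos : 0 < rdeg f := by lia
    rcases max_choice f.num.natDegree f.denom.natDegree with h1 | h1 <;>
      change rdeg f = _ at h1
    · rw [h1, coeff_natDegree, leadingCoeff_eq_zero] at hc
      rw [hc, natDegree_zero] at h1
      lia
    · rw [h1, coeff_natDegree, leadingCoeff_eq_zero] at h0
      exact f.denom_ne_zero h0
  have hq : (reflect (rdeg f) f.denom).eval 0 = f.denom.coeff (rdeg f) := by
    rw [← coeff_zero_eq_eval_zero, coeff_reflect, revAt_le (Nat.zero_le _), Nat.sub_zero]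
  have hp : (reflect (rdeg f) f.num).eval 0 = f.num.coeff (rdeg f) := by
    rw [← coeff_zero_eq_eval_zero, coeff_reflect, revAt_le (Nat.zero_le _), Nat.sub_zero]
  have hden : (flip f).denom.eval 0 ≠ 0 := by
    intro h0
    refine hcd ?_
    rw [← hq]
    refine eval_eq_zero_of_dvd_of_eval_eq_zero ?_ h0
    rw [flip_eq]
    exact RatFunc.denom_div_dvd _ _
  have hnum := congrArg (Polynomial.eval 0)
    ((RatFunc.num_mul_eq_mul_denom_iff (reflect_denom_ne_zero f)).mpr (flip_eq f))
  rw [eval_mul, eval_mul, hq, hp, hc] at hnum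
  change evalF (flip f) 0 = a
  rw [evalF_eq_iff, fibrePoly_coe]
  refine mul_right_cancel₀ hcd ?_
  rw [eval_sub, eval_mul, eval_C]
  linear_combination hnum

theorem eq_C_mul_pow_of_roots {p : ℂ[X]} {a : ℂ} (h : ∀ x, p.eval x = 0 → x = a) :
    p = Polynomial.C p.leadingCoeff * (Polynomial.X - Polynomial.C a) ^ p.natDegree := by
  rcases eq_or_ne p 0 with rfl | hp
  · simp
  have hs := IsAlgClosed.splits p
  have hr : p.roots = Multiset.replicate p.natDegree a := by
    rw [Multiset.eq_replicate]
    exact ⟨hs.natDegree_eq_card_roots.symm, fun x hx ↦ h x ((mem_roots hp).mp hx)⟩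
  conv_lhs => rw [hs.eq_prod_roots, hr]
  simp

theorem ne_C_of_rdeg_pos {f : RatFunc ℂ} (hf : 0 < rdeg f) (c : ℂ) : f ≠ RatFunc.C c := by
  rintro rfl
  simp [rdeg] at hf

theorem rdeg_le_max_fibrePoly (f : RatFunc ℂ) (a : ℂ) :
    rdeg f ≤ max (fibrePoly f (a : OnePoint ℂ)).natDegree f.denom.natDegree := by
  refine max_le ?_ (le_max_right _ _)
  have h : f.num = fibrePoly f (a : OnePoint ℂ) + Polynomial.C a * f.denom := by
    rw [fibrePoly_coe]; ring
  calc f.num.natDegree ≤ _ := h ▸ natDegree_add_le _ _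
    _ ≤ _ := max_le_max le_rfl (natDegree_C_mul_le _ _)

theorem exists_eval_eq_zero {p : ℂ[X]} (hp : p.natDegree ≠ 0) : ∃ x, p.eval x = 0 :=
  IsAlgClosed.exists_root p fun h ↦ hp (natDegree_eq_of_degree_eq_some h)

theorem algebraMap_C_mul_pow (c a : ℂ) (k : ℕ) :
    algebraMap ℂ[X] (RatFunc ℂ) (Polynomial.C c * (Polynomial.X - Polynomial.C a) ^ k) =
      RatFunc.C c * (RatFunc.X - RatFunc.C a) ^ k := by
  simp

theorem conjugate_of_zpow {f : RatFunc ℂ} {m : ℕ} {e : ℤ} (he : e = m ∨ e = -m)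
    (h : Conjugate f (RatFunc.X ^ e)) :
    Conjugate f (RatFunc.X ^ m) ∨ Conjugate f ((RatFunc.X ^ m)⁻¹) := by
  rcases he with rfl | rfl
  · exact .inl (by simpa using h)
  · exact .inr (by simpa using h)

theorem conjugate_of_fibres_coe_infty {f : RatFunc ℂ} (hf : 2 ≤ rdeg f) {a : ℂ}
    (h : ∀ x : ℂ, evalF f x = a ∨ evalF f x = ∞ → x = a) :
    Conjugate f (RatFunc.X ^ rdeg f) ∨ Conjugate f ((RatFunc.X ^ rdeg f)⁻¹) := by
  have hnc := ne_C_of_rdeg_pos (f := f) (by lia)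
  have hF := eq_C_mul_pow_of_roots (p := fibrePoly f (a : OnePoint ℂ)) (a := a)
    fun x hx ↦ h x (.inl ((evalF_eq_iff _ _ _).mpr hx))
  have hQ := eq_C_mul_pow_of_roots (p := f.denom) (a := a)
    fun x hx ↦ h x (.inr ((evalF_eq_iff _ _ _).mpr hx))
  have hmax := rdeg_le_max_fibrePoly f a
  have hFm := natDegree_fibrePoly_le f a
  have hQm := natDegree_fibrePoly_le f ∞
  rw [fibrePoly_infty] at hQm
  have hc := leadingCoeff_ne_zero.mpr (fibrePoly_ne_zero hnc a)
  have hd := leadingCoeff_ne_zero.mpr f.denom_ne_zero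
  have hsub := algebraMap_fibrePoly f a
  have hzero : (fibrePoly f (a : OnePoint ℂ)).natDegree = 0 ∨ f.denom.natDegree = 0 := by
    by_contra! hne
    obtain ⟨x, hx⟩ := exists_eval_eq_zero hne.1
    obtain ⟨y, hy⟩ := exists_eval_eq_zero hne.2
    have hx' := (evalF_eq_iff f x (a : OnePoint ℂ)).mpr hx
    have hy' := (evalF_eq_iff f y ∞).mpr hy
    rw [h x (.inl hx')] at hx'
    rw [h y (.inr hy'), hx'] at hy'
    exact OnePoint.coe_ne_infty _ hy'
  generalize (fibrePoly f (a : OnePoint ℂ)).leadingCoeff = c at *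
  generalize f.denom.leadingCoeff = d at *
  generalize (fibrePoly f (a : OnePoint ℂ)).natDegree = k at *
  generalize f.denom.natDegree = l at *
  rw [hF, hQ, algebraMap_C_mul_pow, algebraMap_C_mul_pow] at hsub
  have hX : (RatFunc.X : RatFunc ℂ) - RatFunc.C a ≠ 0 := sub_ne_zero.mpr (X_ne_C a)
  have he : (k : ℤ) - l = rdeg f ∨ (k : ℤ) - l = -rdeg f := by lia
  refine conjugate_of_zpow he (conjugate_of_affine (a := a) (c := c / d) (div_ne_zero hc hd)
    (by lia) (by lia) ?_)
  have hD := C_ne_zero hd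
  rw [← sub_eq_iff_eq_add', zpow_sub₀ hX, zpow_natCast, zpow_natCast, map_div₀]
  field_simp
  linear_combination -hsub

theorem conjugate_of_fibres_coe_coe {f : RatFunc ℂ} (hf : 2 ≤ rdeg f) {a b : ℂ} (hab : a ≠ b)
    (h : ∀ x : OnePoint ℂ, evalOP f x = a ∨ evalOP f x = b → x = a ∨ x = b) :
    Conjugate f (RatFunc.X ^ rdeg f) ∨ Conjugate f ((RatFunc.X ^ rdeg f)⁻¹) := by
  have hnc := ne_C_of_rdeg_pos (f := f) (by lia)
  have hinf : ¬ (evalOP f ∞ = a ∨ evalOP f ∞ = b) := fun hi ↦ by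
    rcases h ∞ hi with h | h <;> exact OnePoint.infty_ne_coe _ h
  push Not at hinf
  have hdeg : ∀ {w : ℂ}, evalOP f ∞ ≠ w → (fibrePoly f (w : OnePoint ℂ)).natDegree = rdeg f :=
    fun hw ↦ (natDegree_fibrePoly_le _ _).antisymm (not_lt.mp fun hlt ↦ hw (evalOP_infty_eq hlt))
  have h' : ∀ x : ℂ, evalF f x = a ∨ evalF f x = b → x = a ∨ x = b := fun x hx ↦ by
    simpa [OnePoint.coe_eq_coe] using h x hx
  have hab' : (a : OnePoint ℂ) ≠ b := by simpa using hab
  obtain ⟨x, hx⟩ := exists_eval_eq_zero (p := fibrePoly f (a : OnePoint ℂ))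
    (by rw [hdeg hinf.1]; lia)
  obtain ⟨y, hy⟩ := exists_eval_eq_zero (p := fibrePoly f (b : OnePoint ℂ))
    (by rw [hdeg hinf.2]; lia)
  rw [← evalF_eq_iff] at hx hy
  have hxy : (x = a ∧ y = b) ∨ (x = b ∧ y = a) := by
    have hne : x ≠ y := by rintro rfl; exact hab' (hx.symm.trans hy)
    have := h' x (.inl hx)
    have := h' y (.inr hy)
    grind
  have hFx : ∀ z, (fibrePoly f (a : OnePoint ℂ)).eval z = 0 → z = x := fun z hz ↦ by
    rw [← evalF_eq_iff] at hz
    have hne : z ≠ y := by rintro rfl; exact hab' (hz.symm.trans hy)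
    have := h' z (.inl hz)
    grind
  have hFy : ∀ z, (fibrePoly f (b : OnePoint ℂ)).eval z = 0 → z = y := fun z hz ↦ by
    rw [← evalF_eq_iff] at hz
    have hne : z ≠ x := by rintro rfl; exact hab' (hx.symm.trans hz)
    have := h' z (.inr hz)
    grind
  have hFa := eq_C_mul_pow_of_roots hFx
  have hFb := eq_C_mul_pow_of_roots hFy
  rw [hdeg hinf.1] at hFa
  rw [hdeg hinf.2] at hFb
  have hc := leadingCoeff_ne_zero.mpr (fibrePoly_ne_zero hnc a)
  have hd := leadingCoeff_ne_zero.mpr (fibrePoly_ne_zero hnc b)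
  have hsa := algebraMap_fibrePoly f a
  have hsb := algebraMap_fibrePoly f b
  generalize (fibrePoly f (a : OnePoint ℂ)).leadingCoeff = c at *
  generalize (fibrePoly f (b : OnePoint ℂ)).leadingCoeff = d at *
  rw [hFa, algebraMap_C_mul_pow] at hsa
  rw [hFb, algebraMap_C_mul_pow] at hsb
  have hratio : (f - RatFunc.C a) / (f - RatFunc.C b) =
      RatFunc.C (c / d) * ((RatFunc.X - RatFunc.C x) / (RatFunc.X - RatFunc.C y)) ^ rdeg f := by
    rw [← mul_div_mul_right _ _ (RatFunc.algebraMap_ne_zero f.denom_ne_zero), ← hsa, ← hsb,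
      map_div₀, div_pow, mul_div_mul_comm]
  rcases hxy with ⟨rfl, rfl⟩ | ⟨rfl, rfl⟩
  · exact conjugate_of_zpow (e := rdeg f) (.inl rfl) (conjugate_of_crossRatio hab
      (div_ne_zero hc hd) (by lia) (by lia) (hnc _) (by rw [hratio, zpow_natCast]))
  · exact conjugate_of_zpow (e := -rdeg f) (.inr rfl) (conjugate_of_crossRatio hab
      (div_ne_zero hc hd) (by lia) (by lia) (hnc _)
      (by rw [hratio, zpow_neg, zpow_natCast, ← inv_pow, inv_div]))

/-- **Corollary (signature `{n,n}`).** If `A` has degree `m ≥ 2` and `A : O → O` is a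
minimal holomorphic self-map of an orbifold with exactly two singular points, both of
ramification `n ≥ 2`, then `m ≥ n` unless `A` is conjugate to `z^m` or `z^{-m}`. -/
theorem signature_nn_degree_bound (A : RatFunc ℂ) (m : ℕ) (hm : 2 ≤ m)
    (hdeg : rdeg A = m) (n : ℕ) (hn : 2 ≤ n) (O : Orbifold)
    (z₁ z₂ : OnePoint ℂ) (hz : z₁ ≠ z₂)
    (h₁ : O.nu z₁ = n) (h₂ : O.nu z₂ = n)
    (hother : ∀ z, z ≠ z₁ → z ≠ z₂ → O.nu z = 1)
    (hmin : IsMinHolo A O O) :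
    n ≤ m ∨ Conjugate A (RatFunc.X ^ m) ∨ Conjugate A ((RatFunc.X ^ m)⁻¹) := by

  refine or_iff_not_imp_left.mpr fun hnm ↦ ?_
  subst hdeg
  have hnc := ne_C_of_rdeg_pos (f := A) (by lia)
  have hpre : ∀ x, evalOP A x = z₁ ∨ evalOP A x = z₂ → x = z₁ ∨ x = z₂ := by
    intro x hx
    by_contra! hne
    have hν : O.nu (evalOP A x) = n := by rcases hx with hx | hx <;> rw [hx] <;> assumption
    have hgcd := hmin x
    rw [hν, hother x hne.1 hne.2, one_mul] at hgcd
    have hdvd : n ∣ locDeg A x := hgcd ▸ Nat.gcd_dvd_left _ _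
    exact hnm ((Nat.le_of_dvd (locDeg_pos hnc x) hdvd).trans (locDeg_le hnc x))
  induction z₁ using OnePoint.rec with
  | infty =>
    induction z₂ using OnePoint.rec with
    | infty => exact absurd rfl hz
    | coe b =>
      exact conjugate_of_fibres_coe_infty (a := b) hm fun x hx ↦ by
        simpa [OnePoint.coe_eq_coe] using hpre x hx.symm
  | coe a =>
    induction z₂ using OnePoint.rec with
    | infty =>
      exact conjugate_of_fibres_coe_infty (a := a) hm fun x hx ↦ by
        simpa [OnePoint.coe_eq_coe] using hpre x hx
    | coe b =>
      exact conjugate_of_fibres_coe_coe hm (by simpa using hz) hpre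

end GenLattes
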